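/- arXiv:2411.00899 — 2 statements merged into one kernel-verified Lean document; each statement's English description precedes it below -/
import Mathlib

section
/- Randomized smoothing certification (Neyman–Pearson bound for Gaussian smoothing): Let f : ℝ^d → Y be any measurable classifier and g(x) = argmax_c P(f(x + ε) = c) with ε ∼ N(0, σ²I). If P(f(x+ε) = c_A) ≥ p_A and max_{c ≠ c_A} P(f(x+ε) = c) ≤ p_B with p_A ≥ p_B, then g(x + δ) = c_A for all δ with ‖δ‖₂ < (σ/2)(Φ⁻¹(p_A) − Φ⁻¹(p_B)). -/
open MeasureTheory ProbabilityTheory Set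

/-- The isotropic Gaussian measure `N(x, vI)` on `ℝ^d` (as `EuclideanSpace ℝ (Fin d)`),
with mean `x` and per-coordinate variance `v`. -/
noncomputable def gaussianPi (d : ℕ) (x : EuclideanSpace ℝ (Fin d)) (v : NNReal) :
    Measure (EuclideanSpace ℝ (Fin d)) :=
  (Measure.pi fun i => gaussianReal (x i) v).map ⇑(EuclideanSpace.equiv (Fin d) ℝ).symm

/-- The cumulative distribution function of the standard normal distribution. -/
noncomputable def stdNormCDF (t : ℝ) : ℝ := ((gaussianReal 0 1) (Set.Iic t)).toReal


lemma rs_np {Ω : Type*} [MeasurableSpace Ω] (μ : Measure Ω) [IsFiniteMeasure μ]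
    (h : Ω → ENNReal) (k : ENNReal) (A S : Set Ω) (hA : MeasurableSet A)
    (hS : MeasurableSet S) (hlo : ∀ z ∈ A, h z ≤ k) (hhi : ∀ z ∉ A, k ≤ h z)
    (hle : μ A ≤ μ S) : μ.withDensity h A ≤ μ.withDensity h S := by
  have h1 : μ (A \ S) ≤ μ (S \ A) := by
    have e1 := measure_inter_add_sdiff (μ := μ) A hS
    have e2 := measure_inter_add_sdiff (μ := μ) S hA
    rw [← e1, ← e2, inter_comm] at hle
    exact (ENNReal.add_le_add_iff_left (measure_ne_top _ _)).1 hle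
  rw [← measure_inter_add_sdiff (μ := μ.withDensity h) A hS,
    ← measure_inter_add_sdiff (μ := μ.withDensity h) S hA, inter_comm]
  gcongr 1
  rw [withDensity_apply _ (hA.diff hS), withDensity_apply _ (hS.diff hA)]
  calc _ ≤ ∫⁻ _ in A \ S, k ∂μ := setLIntegral_mono' (hA.diff hS) fun z hz => hlo z hz.1
    _ = k * μ (A \ S) := by simp
    _ ≤ k * μ (S \ A) := by gcongr
    _ = ∫⁻ _ in S \ A, k ∂μ := by simp
    _ ≤ _ := setLIntegral_mono' (hS.diff hA) fun z hz => hhi z hz.2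

lemma rs_dens1 (m t : ℝ) (v : NNReal) (hv : v ≠ 0) :
    gaussianReal (m + t) v = (gaussianReal m v).withDensity
      (fun z => ENNReal.ofReal (Real.exp ((t * (z - m) - t ^ 2 / 2) / v))) := by
  rw [gaussianReal_of_var_ne_zero _ hv, gaussianReal_of_var_ne_zero _ hv,
    ← withDensity_mul _ (measurable_gaussianPDF _ _) (by fun_prop)]
  congr 1
  ext z
  have hv' : (v : ℝ) ≠ 0 := by exact_mod_cast hv
  simp only [gaussianPDF, Pi.mul_apply]
  rw [← ENNReal.ofReal_mul (gaussianPDFReal_nonneg _ _ _)]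
  simp only [gaussianPDFReal]
  rw [mul_assoc _ (Real.exp _), ← Real.exp_add]
  congr 3
  field_simp
  ring

lemma rs_dens (d : ℕ) (m t : Fin d → ℝ) (v : NNReal) (hv : v ≠ 0) :
    Measure.pi (fun i => gaussianReal (m i + t i) v) =
    (Measure.pi (fun i => gaussianReal (m i) v)).withDensity
      (fun z => ENNReal.ofReal (Real.exp ((∑ i, t i * (z i - m i) - (∑ i, t i ^ 2) / 2) / v))) := by
  apply Measure.pi_eq
  intro s hs
  rw [withDensity_apply _ (MeasurableSet.univ_pi hs), ← lintegral_indicator (MeasurableSet.univ_pi hs)]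
  have e : ∀ z : Fin d → ℝ, (univ.pi s).indicator (fun z : Fin d → ℝ => ENNReal.ofReal
      (Real.exp ((∑ i, t i * (z i - m i) - (∑ i, t i ^ 2) / 2) / v))) z =
      ∏ i, (s i).indicator (fun y => ENNReal.ofReal
        (Real.exp ((t i * (y - m i) - t i ^ 2 / 2) / v))) (z i) := by
    intro z
    by_cases hz : z ∈ univ.pi s
    · rw [indicator_of_mem hz]
      have : ∀ i, z i ∈ s i := fun i => hz i (mem_univ i)
      simp only [indicator_of_mem (this _)]
      rw [← ENNReal.ofReal_prod_of_nonneg (fun i _ => (Real.exp_pos _).le), ← Real.exp_sum,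
        ← Finset.sum_div, Finset.sum_sub_distrib, Finset.sum_div _ _ (2 : ℝ)]
    · rw [indicator_of_notMem hz]
      simp only [mem_pi, mem_univ, true_imp_iff, not_forall] at hz
      obtain ⟨i, hi⟩ := hz
      symm
      exact Finset.prod_eq_zero (Finset.mem_univ i) (indicator_of_notMem hi _)
  simp_rw [e]
  have hm : ∀ i, Measurable ((s i).indicator (fun y => ENNReal.ofReal
        (Real.exp ((t i * (y - m i) - t i ^ 2 / 2) / v)))) := fun i =>
    Measurable.indicator (by fun_prop) (hs i)
  rw [lintegral_prod_eq_prod_lintegral_of_indepFun Finset.univ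
    (fun i (z : Fin d → ℝ) => (s i).indicator (fun y => ENNReal.ofReal
        (Real.exp ((t i * (y - m i) - t i ^ 2 / 2) / v))) (z i))
    (iIndepFun_pi (fun i => (hm i).aemeasurable)) (fun i => (hm i).comp (measurable_pi_apply i))]
  refine Finset.prod_congr rfl fun i _ => ?_
  rw [rs_dens1 _ _ _ hv, withDensity_apply _ (hs i), ← lintegral_indicator (hs i)]
  exact (measurePreserving_eval (fun i => gaussianReal (m i) v) i).lintegral_comp (hm i)

lemma rs_law (d : ℕ) (m a : Fin d → ℝ) (v w : NNReal) (hw : (w : ℝ) = v * ∑ i, a i ^ 2) :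
    (Measure.pi (fun i => gaussianReal (m i) v)).map (fun z => ∑ i, a i * z i) =
    gaussianReal (∑ i, a i * m i) w := by
  apply Measure.ext_of_charFun
  ext u
  rw [charFun_apply_real, integral_map (Measurable.aemeasurable (by fun_prop)) (by fun_prop), charFun_gaussianReal]
  have : ∀ z : Fin d → ℝ, Complex.exp (u * ((∑ i, a i * z i : ℝ) : ℂ) * Complex.I) =
    ∏ i, Complex.exp (((u * a i : ℝ) : ℂ) * (z i : ℂ) * Complex.I) := by
    intro z
    rw [← Complex.exp_sum]
    push_cast
    rw [Finset.mul_sum, Finset.sum_mul]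
    congr 2; ext i; ring
  simp_rw [this]
  rw [integral_fintype_prod_eq_prod (fun i (y : ℝ) => Complex.exp (((u * a i : ℝ) : ℂ) * (y : ℂ) * Complex.I))]
  simp_rw [← charFun_apply_real, charFun_gaussianReal]
  rw [← Complex.exp_sum]
  have hw' : (w : ℂ) = v * ∑ i, (a i : ℂ) ^ 2 := by exact_mod_cast congrArg ((↑) : ℝ → ℂ) hw
  rw [hw']
  push_cast
  simp only [Finset.mul_sum, Finset.sum_mul, Finset.sum_div, ← Finset.sum_sub_distrib]
  congr 2; ext i; ring

/-- half-space probability -/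
lemma rs_half (d : ℕ) (m t : Fin d → ℝ) (s : NNReal) (hs : 0 < s) (r c : ℝ) (hr : 0 < r)
    (hrt : r ^ 2 = ∑ i, t i ^ 2) (c' : ℝ) (hc : c' = ∑ i, t i * m i + s * r * c) :
    Measure.pi (fun i => gaussianReal (m i) (s ^ 2)) {z | ∑ i, t i * z i ≤ c'} =
      gaussianReal 0 1 (Iic c) := by
  have h1 := rs_law d m t (s ^ 2) (s ^ 2 * ⟨r, hr.le⟩ ^ 2) (by push_cast; rw [← hrt]; rfl)
  have h2 : (gaussianReal 0 1).map (fun y => (s * r) * y) =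
    gaussianReal 0 (s ^ 2 * ⟨r, hr.le⟩ ^ 2) := by
    rw [gaussianReal_map_const_mul]
    congr 1
    · simp
    · ext; simp [mul_pow]; exact Or.inl rfl
  have h3 : ((gaussianReal 0 1).map (fun y => (s * r) * y)).map (fun y => y + ∑ i, t i * m i) =
    gaussianReal (∑ i, t i * m i) (s ^ 2 * ⟨r, hr.le⟩ ^ 2) := by
    rw [h2, gaussianReal_map_add_const]; simp
  rw [← h1, Measure.map_map (by fun_prop) (by fun_prop)] at h3
  have h4 := congrArg (fun M => M (Iic c')) h3
  rw [Measure.map_apply (by fun_prop) measurableSet_Iic,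
    Measure.map_apply (by fun_prop) measurableSet_Iic] at h4
  have hpos : 0 < (s : ℝ) * r := by positivity
  calc _ = _ := h4.symm
    _ = _ := by
      congr 1
      ext y
      simp only [mem_preimage, Function.comp, mem_Iic, hc]
      rw [add_comm, add_le_add_iff_left, mul_le_mul_iff_right₀ hpos]

lemma rs_cdf_mono {a b : ℝ} (h : a < b) : gaussianReal 0 1 (Iic a) < gaussianReal 0 1 (Iic b) := by
  rw [← Iic_union_Ioc_eq_Iic h.le, measure_union (Iic_disjoint_Ioc le_rfl) measurableSet_Ioc]
  refine ENNReal.lt_add_right (measure_ne_top _ _) fun h0 => ?_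
  have := gaussianReal_absolutelyContinuous' 0 one_ne_zero h0
  simp at this
  linarith

lemma rs_cdf_neg (a : ℝ) : gaussianReal 0 1 (Iic (-a)) = 1 - gaussianReal 0 1 (Iic a) := by
  rw [← prob_compl_eq_one_sub measurableSet_Iic, compl_Iic]
  have h := gaussianReal_map_neg (μ := 0) (v := 1)
  rw [neg_zero] at h
  rw [← h, Measure.map_apply (by fun_prop) measurableSet_Iic, h]
  have := nullSingletonClass_gaussianReal (μ := 0) (v := 1) one_ne_zero
  rw [measure_congr Ioi_ae_eq_Ici]
  congr 1
  ext y; simp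

lemma rs_shift (d : ℕ) (m t : Fin d → ℝ) (s : NNReal) (hs : 0 < s) (r c : ℝ) (hr : 0 ≤ r)
    (hrt : r ^ 2 = ∑ i, t i ^ 2) (S : Set (Fin d → ℝ)) (hS : MeasurableSet S)
    (h : gaussianReal 0 1 (Iic c) ≤ Measure.pi (fun i => gaussianReal (m i) (s ^ 2)) S) :
    gaussianReal 0 1 (Iic (c - r / s)) ≤
      Measure.pi (fun i => gaussianReal (m i + t i) (s ^ 2)) S := by
  have hs' : (0 : ℝ) < s := by exact_mod_cast hs
  rcases hr.eq_or_lt with rfl | hr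
  · have : ∀ i, t i = 0 := by
      intro i
      have h0 : ∑ i, t i ^ 2 = 0 := by rw [← hrt]; simp
      rw [Finset.sum_eq_zero_iff_of_nonneg (fun i _ => sq_nonneg _)] at h0
      simpa using h0 i (Finset.mem_univ i)
    simpa [this] using h
  have hA : MeasurableSet {z : Fin d → ℝ | ∑ i, t i * z i ≤ ∑ i, t i * m i + s * r * c} :=
    measurableSet_le (by fun_prop) (by fun_prop)
  rw [← rs_half d (fun i => m i + t i) t s hs r (c - r / s) hr hrt
    (∑ i, t i * m i + s * r * c) ?_]
  · rw [← rs_half d m t s hs r c hr hrt _ rfl] at h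
    rw [rs_dens d m t _ (by positivity)]
    refine rs_np _ _ (ENNReal.ofReal (Real.exp ((s * r * c - (∑ i, t i ^ 2) / 2) / (s ^ 2 : NNReal))))
      _ _ hA hS ?_ ?_ h
    · intro z hz
      simp only [mem_ofPred_eq] at hz
      simp only [mul_sub, Finset.sum_sub_distrib]
      gcongr
      linarith
    · intro z hz
      simp only [mem_ofPred_eq, not_le] at hz
      simp only [mul_sub, Finset.sum_sub_distrib]
      gcongr
      linarith
  · simp only [mul_add, Finset.sum_add_distrib, mul_sub]
    have : ∑ i, t i * t i = r ^ 2 := by rw [hrt]; congr 1; ext; ring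
    rw [this]; field_simp; ring

lemma rs_gp (d : ℕ) (y : EuclideanSpace ℝ (Fin d)) (v : NNReal)
    (S : Set (EuclideanSpace ℝ (Fin d))) (hS : MeasurableSet S) :
    gaussianPi d y v S = Measure.pi (fun i => gaussianReal (y i) v)
      ((EuclideanSpace.equiv (Fin d) ℝ).symm ⁻¹' S) := by
  rw [gaussianPi, Measure.map_apply (EuclideanSpace.equiv (Fin d) ℝ).symm.continuous.measurable hS]

lemma rs_gp_prob (d : ℕ) (y : EuclideanSpace ℝ (Fin d)) (v : NNReal) :
    IsProbabilityMeasure (gaussianPi d y v) :=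
  Measure.isProbabilityMeasure_map
    (EuclideanSpace.equiv (Fin d) ℝ).symm.continuous.measurable.aemeasurable

lemma rs_gp_ac (d : ℕ) (x δ : EuclideanSpace ℝ (Fin d)) (v : NNReal) (hv : v ≠ 0)
    (S : Set (EuclideanSpace ℝ (Fin d))) (hS : MeasurableSet S) (h : gaussianPi d x v S = 0) :
    gaussianPi d (x + δ) v S = 0 := by
  rw [rs_gp d _ v S hS] at h ⊢
  simp only [PiLp.add_apply]
  rw [rs_dens d (fun i => x i) (fun i => δ i) v hv]
  exact withDensity_absolutelyContinuous _ _ h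

lemma rs_gp_shift (d : ℕ) (x δ : EuclideanSpace ℝ (Fin d)) (s : NNReal) (hs : 0 < s) (c : ℝ)
    (S : Set (EuclideanSpace ℝ (Fin d))) (hS : MeasurableSet S)
    (h : gaussianReal 0 1 (Iic c) ≤ gaussianPi d x (s ^ 2) S) :
    gaussianReal 0 1 (Iic (c - ‖δ‖ / s)) ≤ gaussianPi d (x + δ) (s ^ 2) S := by
  rw [rs_gp d _ _ S hS] at h ⊢
  simp only [PiLp.add_apply]
  exact rs_shift d (fun i => x i) (fun i => δ i) s hs ‖δ‖ c (norm_nonneg _)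
    (EuclideanSpace.real_norm_sq_eq δ) _
    ((EuclideanSpace.equiv (Fin d) ℝ).symm.continuous.measurable hS) h

lemma rs_cdf_eq {a p : ℝ} (h : stdNormCDF a = p) :
    gaussianReal 0 1 (Iic a) = ENNReal.ofReal p := by
  rw [← h, stdNormCDF, ENNReal.ofReal_toReal (measure_ne_top _ _)]

/-- Randomized smoothing certification (Cohen et al.): let `f : ℝ^d → Y` be a measurable
classifier and `g(y) = argmax_c P(f(y + ε) = c)` with `ε ∼ N(0, σ²I)`.  If
`P(f(x+ε) = c_A) ≥ p_A` and `P(f(x+ε) = c) ≤ p_B` for every `c ≠ c_A`, with `p_A ≥ p_B`,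
then `g(x + δ) = c_A` for all `δ` with `‖δ‖₂ < (σ/2)(Φ⁻¹(p_A) − Φ⁻¹(p_B))`. -/
theorem randomized_smoothing_certification
    (d : ℕ) {Y : Type*} [Fintype Y] [Nonempty Y]
    (σ : NNReal) (hσ : 0 < σ)
    (f : EuclideanSpace ℝ (Fin d) → Y)
    (hf : ∀ c : Y, MeasurableSet {z | f z = c})
    (g : EuclideanSpace ℝ (Fin d) → Y)
    (hg : ∀ (y : EuclideanSpace ℝ (Fin d)) (c : Y),
      gaussianPi d y (σ ^ 2) {z | f z = c} ≤ gaussianPi d y (σ ^ 2) {z | f z = g y})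
    (Phiinv : ℝ → ℝ) (hinv : ∀ p ∈ Set.Ioo (0 : ℝ) 1, stdNormCDF (Phiinv p) = p)
    (x : EuclideanSpace ℝ (Fin d)) (cA : Y) (pA pB : ℝ)
    (hpA : pA ∈ Set.Icc (0 : ℝ) 1) (hpB : pB ∈ Set.Icc (0 : ℝ) 1) (hAB : pB ≤ pA)
    (hA : ENNReal.ofReal pA ≤ gaussianPi d x (σ ^ 2) {z | f z = cA})
    (hB : ∀ c ≠ cA, gaussianPi d x (σ ^ 2) {z | f z = c} ≤ ENNReal.ofReal pB) :
    ∀ δ : EuclideanSpace ℝ (Fin d),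
      ‖δ‖ < (σ : ℝ) / 2 * (Phiinv pA - Phiinv pB) → g (x + δ) = cA := by
  intro δ hδ
  have hv : σ ^ 2 ≠ 0 := by positivity
  have hσ' : (0 : ℝ) < σ := by exact_mod_cast hσ
  have := rs_gp_prob d x (σ ^ 2)
  have := rs_gp_prob d (x + δ) (σ ^ 2)
  have full : gaussianPi d x (σ ^ 2) {z | f z = cA}ᶜ = 0 → g (x + δ) = cA := by
    intro h0
    have h1 := rs_gp_ac d x δ _ hv _ (hf cA).compl h0
    by_contra hne
    have h2 : gaussianPi d (x + δ) (σ ^ 2) {z | f z = g (x + δ)} = 0 :=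
      measure_mono_null (fun z hz hz' => hne (Eq.trans (Eq.symm hz) hz')) h1
    have h3 := hg (x + δ) cA
    rw [h2, (prob_compl_eq_zero_iff (hf cA)).1 h1] at h3
    simp at h3
  by_cases hA1 : pA = 1
  · apply full
    rw [prob_compl_eq_zero_iff (hf cA)]
    refine le_antisymm prob_le_one ?_
    simpa [hA1] using hA
  by_cases hB0 : pB = 0
  · apply full
    have : {z | f z = cA}ᶜ = ⋃ c : {c : Y // c ≠ cA}, {z | f z = c} := by
      ext z; simp
    rw [this]
    refine measure_iUnion_null fun c => ?_
    simpa [hB0] using hB c c.2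
  have hA' : pA ∈ Ioo (0 : ℝ) 1 :=
    ⟨lt_of_lt_of_le (lt_of_le_of_ne hpB.1 (Ne.symm hB0)) hAB, lt_of_le_of_ne hpA.2 hA1⟩
  have hB' : pB ∈ Ioo (0 : ℝ) 1 :=
    ⟨lt_of_le_of_ne hpB.1 (Ne.symm hB0), lt_of_le_of_lt hAB hA'.2⟩
  by_contra hne
  have ea := rs_cdf_eq (hinv pA hA')
  have eb := rs_cdf_eq (hinv pB hB')
  have h1 := rs_gp_shift d x δ σ hσ (Phiinv pA) _ (hf cA) (by rw [ea]; exact hA)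
  have h2 := rs_gp_shift d x δ σ hσ (-Phiinv pB) _ (hf (g (x + δ))).compl (by
    rw [rs_cdf_neg, eb, prob_compl_eq_one_sub (hf _)]
    exact tsub_le_tsub_left (hB _ hne) _)
  rw [← neg_add', rs_cdf_neg, prob_compl_eq_one_sub (hf _)] at h2
  have h3 : gaussianPi d (x + δ) (σ ^ 2) {z | f z = g (x + δ)} ≤
      gaussianReal 0 1 (Iic (Phiinv pB + ‖δ‖ / σ)) := by
    refine (ENNReal.sub_le_sub_iff_left ?_ ENNReal.one_ne_top).1 h2
    exact prob_le_one
  have h4 : Phiinv pB + ‖δ‖ / σ < Phiinv pA - ‖δ‖ / σ := by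
    have : ‖δ‖ / σ < (Phiinv pA - Phiinv pB) / 2 := by
      rw [div_lt_iff₀ hσ']; linarith
    linarith
  exact absurd ((h1.trans (hg (x + δ) cA)).trans h3) (not_le.2 (rs_cdf_mono h4))
end

section
/- The smoothed classifier's confidence function x ↦ P(f(x+ε) = c) with ε ∼ N(0, σ²I) is Lipschitz-continuous after applying Φ⁻¹: the map x ↦ Φ⁻¹(P(f(x+ε)=c)) is (1/σ)-Lipschitz with respect to the Euclidean norm, whenever the probability lies strictly in (0,1). -/
open MeasureTheory ProbabilityTheory Set

theorem np_aux {α : Type*} [MeasurableSpace α] (μ : Measure α) [IsFiniteMeasure μ]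
    (g : α → ENNReal) (k : ENNReal) (A H : Set α) (hA : MeasurableSet A) (hH : MeasurableSet H)
    (hAH : μ A = μ H) (h1 : ∀ z ∈ H, k ≤ g z) (h2 : ∀ z, z ∉ H → g z ≤ k) :
    μ.withDensity g A ≤ μ.withDensity g H := by
  have e : μ (A \ H) = μ (H \ A) := by
    have a1 := measure_inter_add_sdiff (μ := μ) A hH
    have a2 := measure_inter_add_sdiff (μ := μ) H hA
    rw [inter_comm] at a2
    rw [hAH, ← a2] at a1
    exact (ENNReal.add_right_inj (measure_ne_top μ _)).1 a1
  have b1 := measure_inter_add_sdiff (μ := μ.withDensity g) A hH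
  have b2 := measure_inter_add_sdiff (μ := μ.withDensity g) H hA
  rw [inter_comm] at b2
  rw [← b1, ← b2]
  gcongr 1 with
  rw [withDensity_apply _ (hA.diff hH), withDensity_apply _ (hH.diff hA)]
  calc ∫⁻ z in A \ H, g z ∂μ ≤ ∫⁻ z in A \ H, k ∂μ :=
        setLIntegral_mono' (hA.diff hH) (fun z hz => h2 z hz.2)
    _ = ∫⁻ z in H \ A, k ∂μ := by simp [e]
    _ ≤ _ := setLIntegral_mono' (hH.diff hA) (fun z hz => h1 z hz.1)

theorem gaussianReal_ratio (x y : ℝ) (v : NNReal) (hv : v ≠ 0) :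
    gaussianReal y v = (gaussianReal x v).withDensity
      (fun z => ENNReal.ofReal (Real.exp ((y - x) * (z - x) / v - (y - x) ^ 2 / (2 * v)))) := by
  rw [gaussianReal_of_var_ne_zero _ hv, gaussianReal_of_var_ne_zero _ hv,
    ← withDensity_mul _ (measurable_gaussianPDF x v) (by fun_prop)]
  congr 1
  ext z
  simp only [gaussianPDF, gaussianPDFReal, Pi.mul_apply]
  rw [← ENNReal.ofReal_mul (by positivity), mul_assoc (√(2 * Real.pi * (v : ℝ)))⁻¹, ← Real.exp_add]
  have : (v : ℝ) ≠ 0 := by exact_mod_cast hv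
  congr 3
  field_simp
  ring

theorem pi_withDensity_aux {d : ℕ} (μ ν : Fin d → Measure ℝ) [∀ i, IsProbabilityMeasure (μ i)]
    [∀ i, IsProbabilityMeasure (ν i)]
    (g : Fin d → ℝ → ENNReal) (hg : ∀ i, Measurable (g i))
    (h : ∀ i, ν i = (μ i).withDensity (g i)) :
    Measure.pi ν = (Measure.pi μ).withDensity (fun z => ∏ i, g i (z i)) := by
  apply Measure.pi_eq
  intro s hs
  have hm : ∀ i, Measurable ((s i).indicator (g i)) := fun i => (hg i).indicator (hs i)
  rw [withDensity_apply _ (MeasurableSet.univ_pi hs), ← lintegral_indicator (MeasurableSet.univ_pi hs)]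
  have e : (Set.univ.pi s).indicator (fun z => ∏ i, g i (z i))
      = fun z => ∏ i, (s i).indicator (g i) (z i) := by
    ext z
    by_cases hz : z ∈ Set.univ.pi s
    · rw [indicator_of_mem hz]
      exact Finset.prod_congr rfl (fun i _ => (indicator_of_mem (hz i trivial) _).symm)
    · rw [indicator_of_notMem hz]
      simp only [Set.mem_pi, not_forall] at hz
      obtain ⟨i, _, hi⟩ := hz
      exact (Finset.prod_eq_zero (Finset.mem_univ i) (indicator_of_notMem hi _)).symm
  rw [e, lintegral_prod_eq_prod_lintegral_of_indepFun _ _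
    (iIndepFun_pi (fun i => (hm i).aemeasurable)) (fun i => (hm i).comp (measurable_pi_apply i))]
  refine Finset.prod_congr rfl (fun i _ => ?_)
  rw [(measurePreserving_eval μ i).lintegral_comp (hm i), lintegral_indicator (hs i), h i,
    withDensity_apply _ (hs i)]

theorem gaussianPi_eq (d : ℕ) (x : EuclideanSpace ℝ (Fin d)) (v : NNReal) :
    gaussianPi d x v = (Measure.pi fun i => gaussianReal (x i) v).map (WithLp.toLp 2) := rfl

theorem gaussianPi_apply (d : ℕ) (x : EuclideanSpace ℝ (Fin d)) (v : NNReal)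
    {A : Set (EuclideanSpace ℝ (Fin d))} (hA : MeasurableSet A) :
    gaussianPi d x v A = (Measure.pi fun i => gaussianReal (x i) v) ((WithLp.toLp 2) ⁻¹' A) := by
  rw [gaussianPi_eq, Measure.map_apply (by fun_prop) hA]

instance gaussianPi_prob (d : ℕ) (x : EuclideanSpace ℝ (Fin d)) (v : NNReal) :
    IsProbabilityMeasure (gaussianPi d x v) := by
  rw [gaussianPi_eq]
  exact Measure.isProbabilityMeasure_map (by fun_prop)

theorem gaussianPi_map_inner (d : ℕ) (x u : EuclideanSpace ℝ (Fin d)) (v : NNReal) :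
    (gaussianPi d x v).map (fun z => inner ℝ u z)
      = gaussianReal (inner ℝ u x) (v * ‖u‖₊ ^ 2) := by
  have : IsProbabilityMeasure ((gaussianPi d x v).map (fun z => inner ℝ u z)) :=
    Measure.isProbabilityMeasure_map (by fun_prop)
  apply Measure.ext_of_charFun
  ext s
  have e : charFun ((gaussianPi d x v).map (fun z => inner ℝ u z)) s
      = charFun (gaussianPi d x v) (s • u) := by
    rw [charFun_apply, charFun_apply, integral_map (by fun_prop) (by fun_prop)]
    simp [inner_smul_right, real_inner_comm, mul_comm]
  rw [e, gaussianPi_eq, charFun_pi]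
  simp_rw [charFun_gaussianReal, ← Complex.exp_sum]
  congr 1
  have hn : ((‖u‖ : ℝ) : ℂ) ^ 2 = ∑ i, ((u i : ℝ) : ℂ) ^ 2 := by
    rw [← Complex.ofReal_pow, EuclideanSpace.real_norm_sq_eq]
    push_cast
    rfl
  simp only [PiLp.inner_apply, PiLp.smul_apply, Finset.sum_sub_distrib]
  push_cast
  rw [hn]
  simp [Finset.mul_sum, Finset.sum_mul, Finset.sum_div]
  congr 1 <;> exact Finset.sum_congr rfl (fun i _ => by ring)

theorem gaussianReal_Iic_shift (m t : ℝ) :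
    gaussianReal m 1 (Set.Iic t) = gaussianReal 0 1 (Set.Iic (t - m)) := by
  have := gaussianReal_map_add_const (μ := 0) (v := 1) m
  rw [zero_add] at this
  rw [← this, Measure.map_apply (by fun_prop) measurableSet_Iic]
  congr 1
  ext z
  simp [le_sub_iff_add_le]

theorem gaussianPi_halfspace (d : ℕ) (x u : EuclideanSpace ℝ (Fin d)) (σ : NNReal) (hσ : 0 < σ)
    (hu : ‖u‖ = 1 / σ) (t : ℝ) :
    (gaussianPi d x (σ ^ 2) {z | inner ℝ u z ≤ t}).toReal = stdNormCDF (t - inner ℝ u x) := by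
  have h1 : σ ^ 2 * ‖u‖₊ ^ 2 = 1 := by
    ext
    push_cast
    rw [hu]
    have : (σ : ℝ) ≠ 0 := by exact_mod_cast hσ.ne'
    field_simp
  have := gaussianPi_map_inner d x u (σ ^ 2)
  rw [h1] at this
  rw [stdNormCDF, ← gaussianReal_Iic_shift, ← this, Measure.map_apply (by fun_prop) measurableSet_Iic]
  rfl

theorem one_side (d : ℕ) (σ : NNReal) (hσ : 0 < σ) (A : Set (EuclideanSpace ℝ (Fin d)))
    (hA : MeasurableSet A) (x y : EuclideanSpace ℝ (Fin d)) (t : ℝ)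
    (hxy : x ≠ y) (ht : stdNormCDF t = (gaussianPi d x (σ ^ 2) A).toReal) :
    (gaussianPi d y (σ ^ 2) A).toReal ≤ stdNormCDF (t + (1 / (σ : ℝ)) * ‖x - y‖) := by
  have hs : (0 : ℝ) < σ := by exact_mod_cast hσ
  have hd : 0 < ‖x - y‖ := norm_pos_iff.2 (sub_ne_zero.2 hxy)
  obtain ⟨u, hu⟩ : ∃ u, u = ((σ : ℝ) * ‖x - y‖)⁻¹ • (x - y) := ⟨_, rfl⟩
  have hun : ‖u‖ = 1 / σ := by
    rw [hu, norm_smul, Real.norm_of_nonneg (by positivity)]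
    field_simp
  have hud : inner ℝ u (x - y) = 1 / (σ : ℝ) * ‖x - y‖ := by
    rw [hu, real_inner_smul_left, real_inner_self_eq_norm_sq]
    field_simp
  have hau : x - y = ((σ : ℝ) * ‖x - y‖) • u := by
    rw [hu, smul_smul, mul_inv_cancel₀ (by positivity), one_smul]
  have hH : MeasurableSet {z : EuclideanSpace ℝ (Fin d) | inner ℝ u z ≤ t + inner ℝ u x} :=
    measurableSet_le (by fun_prop) (by fun_prop)
  have ex := gaussianPi_halfspace d x u σ hσ hun (t + inner ℝ u x)
  have ey := gaussianPi_halfspace d y u σ hσ hun (t + inner ℝ u x)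
  rw [add_sub_cancel_right, ht] at ex
  rw [add_sub_assoc, ← inner_sub_right, hud] at ey
  rw [← ey]
  have ex' := (ENNReal.toReal_eq_toReal_iff' (measure_ne_top _ _) (measure_ne_top _ _)).1 ex
  refine ENNReal.toReal_mono (measure_ne_top _ _) ?_
  have hv : σ ^ 2 ≠ 0 := by positivity
  rw [gaussianPi_apply d x _ hA, gaussianPi_apply d x _ hH] at ex'
  rw [gaussianPi_apply d y _ hA, gaussianPi_apply d y _ hH,
    pi_withDensity_aux (fun i => gaussianReal (x i) (σ ^ 2)) (fun i => gaussianReal (y i) (σ ^ 2))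
      _ (fun i => by fun_prop) (fun i => gaussianReal_ratio (x i) (y i) (σ ^ 2) hv)]
  have key : ∀ z : Fin d → ℝ, ∏ i, ENNReal.ofReal (Real.exp ((y i - x i) * (z i - x i) / (σ ^ 2 : NNReal)
        - (y i - x i) ^ 2 / (2 * (σ ^ 2 : NNReal)))) =
      ENNReal.ofReal (Real.exp (-(‖x - y‖ / σ * (inner ℝ u (WithLp.toLp 2 z) - inner ℝ u x))
        - ∑ i, (y i - x i) ^ 2 / (2 * (σ ^ 2 : NNReal)))) := by
    intro z
    rw [← ENNReal.ofReal_prod_of_nonneg (fun _ _ => by positivity), ← Real.exp_sum,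
      Finset.sum_sub_distrib]
    congr 3
    rw [← inner_sub_right, PiLp.inner_apply, Finset.mul_sum, ← Finset.sum_neg_distrib]
    refine Finset.sum_congr rfl (fun i _ => ?_)
    have hi : x i - y i = (σ : ℝ) * ‖x - y‖ * u i := by
      have := congrArg (fun w : EuclideanSpace ℝ (Fin d) => w i) hau
      simpa using this
    have hi' : y i - x i = -((σ : ℝ) * ‖x - y‖ * u i) := by rw [← hi]; ring
    rw [hi']
    simp
    field_simp
  refine np_aux _ _ (ENNReal.ofReal (Real.exp (-(‖x - y‖ / σ * t)
        - ∑ i, (y i - x i) ^ 2 / (2 * (σ ^ 2 : NNReal))))) _ _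
    (measurableSet_preimage (by fun_prop) hA) (measurableSet_preimage (by fun_prop) hH) ex'.symm ?_ ?_
  · intro z hz
    have hz' : inner ℝ u (WithLp.toLp 2 z) ≤ t + inner ℝ u x := hz
    rw [key]
    gcongr
    linarith
  · intro z hz
    have hz' : t + inner ℝ u x < inner ℝ u (WithLp.toLp 2 z) := not_le.1 hz
    rw [key]
    gcongr
    linarith

/-- The map `x ↦ Φ⁻¹(P(f(x+ε) = c))` with `ε ∼ N(0, σ²I)` is `(1/σ)`-Lipschitz in the
Euclidean norm wherever the probability lies strictly in `(0,1)`. -/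
theorem smoothed_confidence_lipschitz
    (d : ℕ) {Y : Type*} (σ : NNReal) (hσ : 0 < σ)
    (f : EuclideanSpace ℝ (Fin d) → Y) (c : Y)
    (hf : MeasurableSet {z | f z = c})
    (Phiinv : ℝ → ℝ) (hmono : StrictMono stdNormCDF)
    (hinv : ∀ q ∈ Set.Ioo (0 : ℝ) 1, stdNormCDF (Phiinv q) = q) :
    ∀ x y : EuclideanSpace ℝ (Fin d),
      (gaussianPi d x (σ ^ 2) {z | f z = c}).toReal ∈ Set.Ioo (0 : ℝ) 1 →
      (gaussianPi d y (σ ^ 2) {z | f z = c}).toReal ∈ Set.Ioo (0 : ℝ) 1 →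
      |Phiinv ((gaussianPi d x (σ ^ 2) {z | f z = c}).toReal) -
          Phiinv ((gaussianPi d y (σ ^ 2) {z | f z = c}).toReal)| ≤
        (1 / (σ : ℝ)) * ‖x - y‖ := by
  have main : ∀ x y : EuclideanSpace ℝ (Fin d),
      (gaussianPi d x (σ ^ 2) {z | f z = c}).toReal ∈ Set.Ioo (0 : ℝ) 1 →
      (gaussianPi d y (σ ^ 2) {z | f z = c}).toReal ∈ Set.Ioo (0 : ℝ) 1 →
      Phiinv ((gaussianPi d y (σ ^ 2) {z | f z = c}).toReal) ≤
        Phiinv ((gaussianPi d x (σ ^ 2) {z | f z = c}).toReal) + (1 / (σ : ℝ)) * ‖x - y‖ := by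
    intro x y hx hy
    by_cases hxy : x = y
    · subst hxy
      simp
    · have h := one_side d σ hσ _ hf x y _ hxy (hinv _ hx)
      rw [← hinv _ hy] at h
      exact hmono.le_iff_le.1 h
  intro x y hx hy
  have h1 := main x y hx hy
  have h2 := main y x hy hx
  rw [norm_sub_rev y x] at h2
  rw [abs_le]
  constructor <;> linarith
end
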